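/- Deciding membership in TRR∀ (the class of finite rule sets Σ such that every restricted chase sequence of ⟨Σ, D⟩ is finite for every database D) is in Π¹₁. -/

import Mathlib

/-!
Common formalization framework for "Restricted Chase Termination: You Want More than Fairness"
(Carral, Gerlach, Larroque, Thomazo).

Syntax is encoded over natural numbers so that all finite objects (rules, databases, knowledge
bases, Turing machines) live in `Primcodable` types, which allows us to speak about
many-one reductions and about the arithmetical/analytical hierarchy.
-/

namespace ChaseTermination

/-! ### Terms, atoms, facts, rules, knowledge bases -/

/-- Ground terms: `Sum.inl c` is the constant `c`, `Sum.inr n` is the null `n`. -/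
abbrev GroundTerm : Type := ℕ ⊕ ℕ

/-- Terms of rules: `Sum.inl v` is the variable `v`, `Sum.inr g` a ground term. -/
abbrev RTerm : Type := ℕ ⊕ GroundTerm

/-- A fact: a predicate (coded by a natural number) applied to ground terms. -/
abbrev Fact : Type := ℕ × List GroundTerm

/-- An atom: a predicate applied to terms. -/
abbrev Atom : Type := ℕ × List RTerm

/-- An existential rule, given by its body and its head (lists of atoms);
the universally quantified variables are those occurring in the body, the existentially
quantified ones are the head variables not occurring in the body. -/
abbrev Rule : Type := List Atom × List Atom

abbrev RuleSet : Type := List Rule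

abbrev Database : Type := List Fact

/-- A knowledge base: a (finite) rule set together with a database. -/
abbrev KB : Type := RuleSet × Database

def atomHasVar (a : Atom) (v : ℕ) : Prop := (Sum.inl v : RTerm) ∈ a.2

def atomNullFree (a : Atom) : Prop := ∀ t ∈ a.2, ∀ n : ℕ, t ≠ Sum.inr (Sum.inr n)

def factNullFree (f : Fact) : Prop := ∀ t ∈ f.2, ∀ n : ℕ, t ≠ Sum.inr n

/-- A database is a finite fact set without nulls. -/
def IsDatabase (D : Database) : Prop := ∀ f ∈ D, factNullFree f

/-- Well-formed rule: non-empty head, no nulls. -/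
def IsRule (r : Rule) : Prop := r.2 ≠ [] ∧ ∀ a ∈ r.1 ++ r.2, atomNullFree a

def IsRuleSet (S : RuleSet) : Prop := ∀ r ∈ S, IsRule r

def IsKB (kb : KB) : Prop := IsRuleSet kb.1 ∧ IsDatabase kb.2

/-- `v` occurs in the body of `r` (i.e. is universally quantified). -/
def bodyVar (r : Rule) (v : ℕ) : Prop := ∃ a ∈ r.1, atomHasVar a v

/-- `v` is an existential variable of `r`. -/
def existVar (r : Rule) (v : ℕ) : Prop := (∃ a ∈ r.2, atomHasVar a v) ∧ ¬ bodyVar r v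

def applyT (σ : ℕ → GroundTerm) : RTerm → GroundTerm
  | Sum.inl v => σ v
  | Sum.inr g => g

def applyA (σ : ℕ → GroundTerm) (a : Atom) : Fact := (a.1, a.2.map (applyT σ))

/-- A trigger: a rule together with a substitution for its (universal) variables. -/
abbrev Trigger : Type := Rule × (ℕ → GroundTerm)

/-- The support of a trigger: the instantiated body. -/
def support (t : Trigger) : Set Fact := {f | ∃ a ∈ t.1.1, f = applyA t.2 a}

/-- A trigger is loaded for `F` if `F` includes its support. -/
def loaded (t : Trigger) (F : Set Fact) : Prop := ∀ a ∈ t.1.1, applyA t.2 a ∈ F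

/-- `σ'` agrees with the substitution of `t` on all universally quantified (body) variables. -/
def agreesOnBody (t : Trigger) (σ' : ℕ → GroundTerm) : Prop :=
  ∀ v, bodyVar t.1 v → σ' v = t.2 v

/-- A trigger is obsolete for `F` if some extension of its substitution to the existential
variables sends the head into `F`. -/
def obsolete (t : Trigger) (F : Set Fact) : Prop :=
  ∃ σ' : ℕ → GroundTerm, agreesOnBody t σ' ∧ ∀ a ∈ t.1.2, applyA σ' a ∈ F

/-- The (ground) terms occurring in a fact set. -/
def termsOf (F : Set Fact) : Set GroundTerm := {g | ∃ f ∈ F, g ∈ f.2}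

/-- `σ'` is a proper output extension of the trigger `t` w.r.t. `F`: it agrees with the trigger
substitution on body variables and maps existential variables to pairwise distinct fresh nulls. -/
def properExt (t : Trigger) (F : Set Fact) (σ' : ℕ → GroundTerm) : Prop :=
  agreesOnBody t σ' ∧
  (∀ v, existVar t.1 v → ∃ n : ℕ, σ' v = Sum.inr n ∧ (Sum.inr n : GroundTerm) ∉ termsOf F) ∧
  (∀ v w, existVar t.1 v → existVar t.1 w → σ' v = σ' w → v = w)

/-- The output of a trigger under an extended substitution. -/
def outputOf (t : Trigger) (σ' : ℕ → GroundTerm) : Set Fact := {f | ∃ a ∈ t.1.2, f = applyA σ' a}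

/-- An active trigger of `S` for `F`: loaded and not obsolete. -/
def Active (S : RuleSet) (F : Set Fact) (t : Trigger) : Prop :=
  t.1 ∈ S ∧ loaded t F ∧ ¬ obsolete t F

/-- One restricted chase step. -/
def ChaseStep (S : RuleSet) (F F' : Set Fact) : Prop :=
  ∃ t : Trigger, Active S F t ∧ ∃ σ', properExt t F σ' ∧ F' = F ∪ outputOf t σ'

def dbSet (D : Database) : Set Fact := {f | f ∈ D}

/-- A (possibly infinite) restricted chase derivation for `⟨S, D⟩`, of length `len ∈ ℕ∞`.
Beyond the length the fact sets stall, so that the result is always `⋃ i, fact i`. -/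
structure Chase (S : RuleSet) (D : Set Fact) where
  len : ℕ∞
  fact : ℕ → Set Fact
  trig : ℕ → Trigger
  ext : ℕ → ℕ → GroundTerm
  init : fact 0 = D
  activeAt : ∀ i : ℕ, (i : ℕ∞) < len → Active S (fact i) (trig i)
  extOk : ∀ i : ℕ, (i : ℕ∞) < len → properExt (trig i) (fact i) (ext i)
  succ : ∀ i : ℕ, (i : ℕ∞) < len → fact (i + 1) = fact i ∪ outputOf (trig i) (ext i)
  stall : ∀ i : ℕ, ¬ ((i : ℕ∞) < len) → fact (i + 1) = fact i

/-- Fairness: every trigger that becomes loaded is eventually obsolete.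
A fair chase derivation is a *restricted chase sequence*; note that for a finite derivation
fairness forces maximality (no active trigger remains at the end). -/
def Fair {S : RuleSet} {D : Set Fact} (c : Chase S D) : Prop :=
  ∀ t : Trigger, t.1 ∈ S → ∀ i : ℕ, loaded t (c.fact i) → ∃ j : ℕ, i ≤ j ∧ obsolete t (c.fact j)

/-- The result of a chase derivation. -/
def chaseResult {S : RuleSet} {D : Set Fact} (c : Chase S D) : Set Fact := ⋃ i, c.fact i

/-- The derivation is infinite (non-terminating). -/
def IsInfinite {S : RuleSet} {D : Set Fact} (c : Chase S D) : Prop := c.len = ⊤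

/-- `TKR∀`: knowledge bases all of whose restricted chase sequences are finite. -/
def TKRall (kb : KB) : Prop :=
  IsKB kb ∧ ¬ ∃ c : Chase kb.1 (dbSet kb.2), IsInfinite c ∧ Fair c

/-- `TRR∀`: rule sets universally terminating for the restricted chase on every database. -/
def TRRall (S : RuleSet) : Prop :=
  IsRuleSet S ∧ ∀ D : Database, IsDatabase D → ¬ ∃ c : Chase S (dbSet D), IsInfinite c ∧ Fair c

/-! ### Breadth-first chase -/

/-- The instance of a trigger: its rule together with its instantiated body (this determines the
substitution on all body variables). -/
def instOf (t : Trigger) : Rule × List Fact := (t.1, t.1.1.map (applyA t.2))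

/-- The set of instances of active triggers (this is what "the number of triggers that are loaded
and not obsolete" counts). -/
def activeInsts (S : RuleSet) (F : Set Fact) : Set (Rule × List Fact) :=
  {p | ∃ t : Trigger, Active S F t ∧ p = instOf t}

/-- The breadth-first condition (†): a trigger loaded at step `i` becomes obsolete within the
next `n` steps, where `n` is the number of active triggers at step `i`. -/
def BreadthFirst {S : RuleSet} {D : Set Fact} (c : Chase S D) : Prop :=
  ∀ i : ℕ, ∀ t : Trigger, t.1 ∈ S → loaded t (c.fact i) →
    ∃ j : ℕ, i ≤ j ∧ j ≤ i + (activeInsts S (c.fact i)).ncard ∧ obsolete t (c.fact j)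

/-- `TKRBF∀`: knowledge bases all of whose breadth-first chase sequences are finite. -/
def TKRBFall (kb : KB) : Prop :=
  IsKB kb ∧ ¬ ∃ c : Chase kb.1 (dbSet kb.2), IsInfinite c ∧ BreadthFirst c

/-- `TRRBF∀`: rule sets whose breadth-first chase terminates on every database. -/
def TRRBFall (S : RuleSet) : Prop :=
  IsRuleSet S ∧ ∀ D : Database, IsDatabase D →
    ¬ ∃ c : Chase S (dbSet D), IsInfinite c ∧ BreadthFirst c

/-! ### Classes of the arithmetical and analytical hierarchies -/

/-- `Π⁰₂` predicates, via the Kleene normal form `∀ m ∃ k. R`. -/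
def Pi02 {α : Type} [Primcodable α] (p : α → Prop) : Prop :=
  ∃ R : α × ℕ → ℕ → Bool, Computable₂ R ∧ ∀ a, p a ↔ ∀ m : ℕ, ∃ k : ℕ, R (a, m) k = true

/-- `Π¹₁` predicates, via the Kleene normal form: `p a` iff for every function `f : ℕ → ℕ` some
finite initial segment of `f` witnesses a computable predicate. -/
def Pi11 {α : Type} [Primcodable α] (p : α → Prop) : Prop :=
  ∃ R : α → List ℕ → Bool, Computable₂ R ∧
    ∀ a, p a ↔ ∀ f : ℕ → ℕ, ∃ k : ℕ, R a ((List.range k).map f) = true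

/-- `Π¹₁`-hardness: every `Π¹₁` problem many-one reduces to `p`. -/
def Pi11Hard {α : Type} [Primcodable α] (p : α → Prop) : Prop :=
  ∀ q : ℕ → Prop, Pi11 q → q ≤₀ p

def Pi11Complete {α : Type} [Primcodable α] (p : α → Prop) : Prop := Pi11 p ∧ Pi11Hard p

/-! ### Non-deterministic Turing machines -/

/-- A non-deterministic Turing machine `(numStates, alphaSize, table)`.
States are `0, …, numStates - 1` with initial state `0`; tape symbols `0, …, alphaSize - 1`
form `Γ` (so `{0,1} ⊆ Γ` iff `2 ≤ alphaSize`), and the blank `B` is coded by `alphaSize`.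
An entry `((q, a), (q', b, d))` means `(q', b, d) ∈ δ(q, a)`, with `d = true` for a right move
and `d = false` for a left move. -/
abbrev NTM : Type := ℕ × ℕ × List ((ℕ × ℕ) × (ℕ × ℕ × Bool))

def NTM.numStates (M : NTM) : ℕ := M.1
def NTM.blank (M : NTM) : ℕ := M.2.1
def NTM.table (M : NTM) : List ((ℕ × ℕ) × (ℕ × ℕ × Bool)) := M.2.2

/-- Well-formedness: `Γ ⊇ {0,1}`, transitions use valid states and symbols, and the machine
never writes the blank. -/
def NTM.WF (M : NTM) : Prop :=
  1 ≤ NTM.numStates M ∧ 2 ≤ NTM.blank M ∧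
    ∀ e ∈ NTM.table M, e.1.1 < NTM.numStates M ∧ e.1.2 ≤ NTM.blank M ∧
      e.2.1 < NTM.numStates M ∧ e.2.2.1 < NTM.blank M

/-- A configuration `(tape, p, q)`: tape contents (a list of symbol codes whose last cell is
blank and in which no proper symbol occurs after a blank), 0-based head position `p`,
and current state `q`. -/
abbrev Config : Type := List ℕ × ℕ × ℕ

def WFConfig (M : NTM) (ρ : Config) : Prop :=
  ρ.2.1 < ρ.1.length ∧ ρ.1.getLast? = some (NTM.blank M) ∧
    (∀ i j : ℕ, i ≤ j → j < ρ.1.length → ρ.1.getD i 0 = NTM.blank M →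
      ρ.1.getD j 0 = NTM.blank M) ∧
    (∀ a ∈ ρ.1, a ≤ NTM.blank M) ∧ ρ.2.2 < NTM.numStates M

/-- The one-step relation `Next_M` between configurations; each step extends the represented
part of the tape by one blank cell. -/
def NTM.Next (M : NTM) (ρ ρ' : Config) : Prop :=
  ∃ q' b : ℕ, ∃ d : Bool,
    ((ρ.2.2, ρ.1.getD ρ.2.1 0), (q', b, d)) ∈ NTM.table M ∧
    (d = true ∨ 1 ≤ ρ.2.1) ∧
    ρ' = (ρ.1.set ρ.2.1 b ++ [NTM.blank M], if d then ρ.2.1 + 1 else ρ.2.1 - 1, q')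

/-- The starting configuration of `M` on a word. -/
def startConfig (M : NTM) (w : List ℕ) : Config := (w ++ [NTM.blank M], 0, 0)

/-- Words are over the input alphabet `{0, 1}`. -/
def IsWord (w : List ℕ) : Prop := ∀ a ∈ w, a < 2

/-- There is a run of `M` starting in `ρ` that visits the state `qr` infinitely often.
(Such a run is necessarily infinite, and every infinite sequence of `Next_M`-successive
configurations is a run; finite runs trivially feature `qr` only finitely many times.) -/
def RecurringFrom (M : NTM) (qr : ℕ) (ρ : Config) : Prop :=
  ∃ c : ℕ → Config, c 0 = ρ ∧ (∀ i, NTM.Next M (c i) (c (i + 1))) ∧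
    ∀ N : ℕ, ∃ i : ℕ, N ≤ i ∧ (c i).2.2 = qr

/-- `M` is non-recurring through `qr` on the configuration `ρ`: every run of `M` on `ρ`
features `qr` only finitely many times. -/
def NonRecurringFrom (M : NTM) (qr : ℕ) (ρ : Config) : Prop := ¬ RecurringFrom M qr ρ

end ChaseTermination
namespace ChaseTermination

/-! ### The rule set `Σ_M` of Section 4 and the databases `D_ρ` -/

/-- Predicate codes. `pF`, `pR` are the ternary time/tape successor predicates. -/
def pF : ℕ := 0
def pR : ℕ := 1
def pCL : ℕ := 2
def pCR : ℕ := 3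
def pReal : ℕ := 4
def pBrake : ℕ := 5
def pNextBr : ℕ := 6
def pEnd : ℕ := 7
/-- The binary letter predicate for the tape symbol `a`. -/
def pLetter (a : ℕ) : ℕ := 8 + 2 * a
/-- The binary state predicate for the state `q`. -/
def pState (q : ℕ) : ℕ := 9 + 2 * q

/-- Variable codes used in the rules: `x, y, x', y', w, w'` are `0, …, 5`. -/
def tv (v : ℕ) : RTerm := Sum.inl v

def A1 (p : ℕ) (s : RTerm) : Atom := (p, [s])
def A2 (p : ℕ) (s t : RTerm) : Atom := (p, [s, t])
def A3 (p : ℕ) (s t u : RTerm) : Atom := (p, [s, t, u])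

/-- `brSet(x, w)` as atoms: `{F(x,w,w), R(x,w,w), Real(x), Brake(w)}`. -/
def brSetA (x w : RTerm) : List Atom := [A3 pF x w w, A3 pR x w w, A1 pReal x, A1 pBrake w]

/-- Tape alphabet including the blank: `Γ ∪ {B}`. -/
def letters (M : NTM) : List ℕ := List.range (NTM.blank M + 1)
def states (M : NTM) : List ℕ := List.range (NTM.numStates M)

/-- The rule `R_Brake`. -/
def ruleBrake (M : NTM) : Rule :=
  ([A1 pBrake (tv 4)],
    ((letters M).map fun a => A2 (pLetter a) (tv 4) (tv 4)) ++
    ((states M).map fun q => A2 (pState q) (tv 4) (tv 4)) ++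
    [A3 pF (tv 4) (tv 4) (tv 4), A3 pR (tv 4) (tv 4) (tv 4),
     A2 pCL (tv 4) (tv 4), A2 pCR (tv 4) (tv 4), A1 pReal (tv 4), A2 pNextBr (tv 4) (tv 4)])

/-- The rule `R_nextBr`. -/
def ruleNextBr : Rule :=
  (brSetA (tv 0) (tv 4) ++ [A2 pNextBr (tv 4) (tv 5)], brSetA (tv 0) (tv 5))

/-- Transition rule for `(q', b, →) ∈ δ(q, a)` and the letter `c`; if `q = qr` a fresh
brake `w'` is created together with a `nextBr`-atom, otherwise the brake `w` is reused. -/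
def mkTransRight (qr q a q' b c : ℕ) : Rule :=
  ([A2 (pState q) (tv 0) (tv 4), A2 (pLetter a) (tv 0) (tv 4), A3 pR (tv 0) (tv 1) (tv 4),
    A2 (pLetter c) (tv 1) (tv 4)] ++ brSetA (tv 0) (tv 4) ++ brSetA (tv 1) (tv 4),
   if q = qr then
     [A2 (pState q') (tv 3) (tv 5), A2 (pLetter c) (tv 3) (tv 5), A2 (pLetter b) (tv 2) (tv 5),
      A3 pR (tv 2) (tv 3) (tv 5), A3 pF (tv 0) (tv 2) (tv 5), A3 pF (tv 1) (tv 3) (tv 5),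
      A2 pCL (tv 2) (tv 5), A2 pCR (tv 3) (tv 5)] ++
      brSetA (tv 2) (tv 5) ++ brSetA (tv 3) (tv 5) ++ [A2 pNextBr (tv 4) (tv 5)]
   else
     [A2 (pState q') (tv 3) (tv 4), A2 (pLetter c) (tv 3) (tv 4), A2 (pLetter b) (tv 2) (tv 4),
      A3 pR (tv 2) (tv 3) (tv 4), A3 pF (tv 0) (tv 2) (tv 4), A3 pF (tv 1) (tv 3) (tv 4),
      A2 pCL (tv 2) (tv 4), A2 pCR (tv 3) (tv 4)] ++ brSetA (tv 2) (tv 4) ++ brSetA (tv 3) (tv 4))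

/-- Transition rule for `(q', b, ←) ∈ δ(q, a)` and the letter `c`. -/
def mkTransLeft (qr q a q' b c : ℕ) : Rule :=
  ([A2 (pState q) (tv 0) (tv 4), A2 (pLetter a) (tv 0) (tv 4), A3 pR (tv 1) (tv 0) (tv 4),
    A2 (pLetter c) (tv 1) (tv 4)] ++ brSetA (tv 0) (tv 4) ++ brSetA (tv 1) (tv 4),
   if q = qr then
     [A2 (pState q') (tv 3) (tv 5), A2 (pLetter c) (tv 3) (tv 5), A2 (pLetter b) (tv 2) (tv 5),
      A3 pR (tv 3) (tv 2) (tv 5), A3 pF (tv 0) (tv 2) (tv 5), A3 pF (tv 1) (tv 3) (tv 5),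
      A2 pCL (tv 3) (tv 5), A2 pCR (tv 2) (tv 5)] ++
      brSetA (tv 2) (tv 5) ++ brSetA (tv 3) (tv 5) ++ [A2 pNextBr (tv 4) (tv 5)]
   else
     [A2 (pState q') (tv 3) (tv 4), A2 (pLetter c) (tv 3) (tv 4), A2 (pLetter b) (tv 2) (tv 4),
      A3 pR (tv 3) (tv 2) (tv 4), A3 pF (tv 0) (tv 2) (tv 4), A3 pF (tv 1) (tv 3) (tv 4),
      A2 pCL (tv 3) (tv 4), A2 pCR (tv 2) (tv 4)] ++ brSetA (tv 2) (tv 4) ++ brSetA (tv 3) (tv 4))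

/-- All transition rules of `Σ_M` (one per table entry and letter `c`). -/
def transRules (M : NTM) (qr : ℕ) : List Rule :=
  (NTM.table M).foldr (fun e acc =>
    ((letters M).map fun cc =>
      if e.2.2.2 = true then mkTransRight qr e.1.1 e.1.2 e.2.1 e.2.2.1 cc
      else mkTransLeft qr e.1.1 e.1.2 e.2.1 e.2.2.1 cc) ++ acc) []

/-- The rule `R_{C_R}` for the letter `a`. -/
def mkCopyRight (a : ℕ) : Rule :=
  ([A2 pCR (tv 2) (tv 5), A3 pF (tv 0) (tv 2) (tv 5), A3 pR (tv 0) (tv 1) (tv 4),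
    A2 (pLetter a) (tv 1) (tv 4)] ++
    brSetA (tv 0) (tv 4) ++ brSetA (tv 2) (tv 5) ++ brSetA (tv 1) (tv 4),
   [A3 pF (tv 1) (tv 3) (tv 5), A3 pR (tv 2) (tv 3) (tv 5), A2 (pLetter a) (tv 3) (tv 5),
    A2 pCR (tv 3) (tv 5)] ++ brSetA (tv 3) (tv 5))

/-- The rule `R_{C_L}` for the letter `a`. -/
def mkCopyLeft (a : ℕ) : Rule :=
  ([A2 pCL (tv 2) (tv 5), A3 pF (tv 0) (tv 2) (tv 5), A3 pR (tv 1) (tv 0) (tv 4),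
    A2 (pLetter a) (tv 1) (tv 4)] ++
    brSetA (tv 0) (tv 4) ++ brSetA (tv 2) (tv 5) ++ brSetA (tv 1) (tv 4),
   [A3 pF (tv 1) (tv 3) (tv 5), A3 pR (tv 3) (tv 2) (tv 5), A2 (pLetter a) (tv 3) (tv 5),
    A2 pCL (tv 3) (tv 5)] ++ brSetA (tv 3) (tv 5))

def copyRightRules (M : NTM) : List Rule := (letters M).map mkCopyRight
def copyLeftRules (M : NTM) : List Rule := (letters M).map mkCopyLeft

/-- The tape-extension rule `R_End`. -/
def ruleEnd (M : NTM) : Rule :=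
  ([A2 pCR (tv 2) (tv 5), A3 pF (tv 0) (tv 2) (tv 5), A2 pEnd (tv 0) (tv 4)] ++
    brSetA (tv 0) (tv 4) ++ brSetA (tv 2) (tv 5),
   [A3 pR (tv 2) (tv 3) (tv 5), A2 (pLetter (NTM.blank M)) (tv 3) (tv 5),
    A2 pEnd (tv 3) (tv 5)] ++ brSetA (tv 3) (tv 5))

/-- The rule set `Σ_M` of Section 4 (simulating `M`, with the designated state `qr`). -/
def SigmaM (M : NTM) (qr : ℕ) : RuleSet :=
  [ruleBrake M, ruleNextBr] ++ transRules M qr ++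
    copyLeftRules M ++ copyRightRules M ++ [ruleEnd M]

/-- The constant `c_i` (0-based). -/
def cst (i : ℕ) : GroundTerm := Sum.inl (i + 1)
/-- The brake constant `w₁` of the database. -/
def w1 : GroundTerm := Sum.inl 0

/-- `brSet(x, w)` as facts. -/
def brSetF (x w : GroundTerm) : List Fact :=
  [(pF, [x, w, w]), (pR, [x, w, w]), (pReal, [x]), (pBrake, [w])]

/-- The database `D_ρ` encoding a configuration `ρ`. -/
def Drho (M : NTM) (ρ : Config) : Database :=
  ((List.range ρ.1.length).map fun i => ((pR, [cst i, cst (i + 1), w1]) : Fact)) ++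
  ((List.range ρ.1.length).map fun i => ((pLetter (ρ.1.getD i 0), [cst i, w1]) : Fact)) ++
  [((pState ρ.2.2, [cst ρ.2.1, w1]) : Fact),
   ((pLetter (NTM.blank M), [cst ρ.1.length, w1]) : Fact),
   ((pEnd, [cst ρ.1.length, w1]) : Fact)] ++
  (List.range (ρ.1.length + 1)).foldr (fun i acc => brSetF (cst i) w1 ++ acc) []

/-! ### Wild frontiers -/

/-- The atoms explicitly required by the wild-frontier condition ("other" atoms are those
not in this set). -/
def wfListed (M : NTM) (ρ : Config) (w : GroundTerm) (x : ℕ → GroundTerm) : Set Fact :=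
  {f | (∃ i < ρ.1.length,
          f = ((pR, [x i, x (i + 1), w]) : Fact) ∨
          f = ((pLetter (ρ.1.getD i 0), [x i, w]) : Fact)) ∨
    f = ((pState ρ.2.2, [x ρ.2.1, w]) : Fact) ∨
    f = ((pEnd, [x ρ.1.length, w]) : Fact) ∨
    f = ((pLetter (NTM.blank M), [x ρ.1.length, w]) : Fact) ∨
    (∃ i ≤ ρ.1.length, f ∈ brSetF (x i) w)}

/-- `F` has a wild frontier of the configuration `ρ` overseen by `w` (Definition 4.4). -/
def WildFrontier (M : NTM) (F : Set Fact) (ρ : Config) (w : GroundTerm) : Prop :=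
  ∃ x : ℕ → GroundTerm,
    ((pReal, [w]) : Fact) ∉ F ∧
    (∀ i < ρ.1.length, ((pR, [x i, x (i + 1), w]) : Fact) ∈ F ∧
      ((pLetter (ρ.1.getD i 0), [x i, w]) : Fact) ∈ F) ∧
    ((pState ρ.2.2, [x ρ.2.1, w]) : Fact) ∈ F ∧
    ((pEnd, [x ρ.1.length, w]) : Fact) ∈ F ∧
    ((pLetter (NTM.blank M), [x ρ.1.length, w]) : Fact) ∈ F ∧
    (∀ i ≤ ρ.1.length, ∀ f ∈ brSetF (x i) w, f ∈ F) ∧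
    (∀ f ∈ F, f ∉ wfListed M ρ w x →
      ∀ i ≤ ρ.1.length, f.2.head? = some (x i) → f.2[1]? = some w)

/-! ### State atoms, generation, bow ties -/

/-- `g` is a brake of `F`. -/
def isBrake (F : Set Fact) (g : GroundTerm) : Prop := ((pBrake, [g]) : Fact) ∈ F

/-- A state atom of `F`: an atom `q(x, w)` with `q` a state of `M` and `x` not a brake. -/
def StateAtom (M : NTM) (F : Set Fact) (f : Fact) : Prop :=
  ∃ q : ℕ, q < NTM.numStates M ∧ ∃ x wb : GroundTerm,
    f = ((pState q, [x, wb]) : Fact) ∧ f ∈ F ∧ ¬ isBrake F x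

/-- `A` precedes `A'` in the derivation `c`: some applied trigger has `A` in its support
and `A'` in its output. -/
def precedes {S : RuleSet} {D : Set Fact} (c : Chase S D) (A A' : Fact) : Prop :=
  ∃ i : ℕ, (i : ℕ∞) < c.len ∧ A ∈ support (c.trig i) ∧ A' ∈ outputOf (c.trig i) (c.ext i)

/-- The fact `f` is generated (newly produced) at step `i` of the derivation `c`. -/
def generatedAt {S : RuleSet} {D : Set Fact} (c : Chase S D) (i : ℕ) (f : Fact) : Prop :=
  (i : ℕ∞) < c.len ∧ f ∈ outputOf (c.trig i) (c.ext i) ∧ f ∉ c.fact i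

/-- The fact `f` is generated by (an application of) one of the rules in `Rs`. -/
def generatedBy {S : RuleSet} {D : Set Fact} (c : Chase S D) (Rs : List Rule) (f : Fact) : Prop :=
  ∃ i : ℕ, generatedAt c i f ∧ (c.trig i).1 ∈ Rs

/-- Semantically meaningful terms: all terms of `F` except the brakes. -/
def semterms (F : Set Fact) : Set GroundTerm := {g | g ∈ termsOf F ∧ ¬ isBrake F g}

/-- The edge relation `E_R`: `(x, y) ∈ E_R` iff `R(x, y, w) ∈ F` for some `w`. -/
def ER (F : Set Fact) (u v : GroundTerm) : Prop := ∃ w, ((pR, [u, v, w]) : Fact) ∈ F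

/-- The weakly connected component of `x` in the graph induced by `E` on the vertex set `V`. -/
def wcc {α : Type} (V : Set α) (E : α → α → Prop) (x : α) : Set α :=
  {z | z ∈ V ∧ Relation.ReflTransGen (fun u v => u ∈ V ∧ v ∈ V ∧ (E u v ∨ E v u)) x z}

/-- Directed tree rooted in `r` on the vertex set `V` with edge relation `E`. -/
def IsDirTree {α : Type} (V : Set α) (E : α → α → Prop) (r : α) : Prop :=
  r ∈ V ∧
  (∀ v ∈ V, Relation.ReflTransGen (fun u v' => u ∈ V ∧ v' ∈ V ∧ E u v') r v) ∧
  (∀ v ∈ V, v ≠ r → ∃! u, u ∈ V ∧ E u v) ∧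
  (∀ u ∈ V, ¬ E u r)

/-- A bow tie with center `(x, y)` (Definition 6.2): `V_x^{-y}` induces a directed tree on the
inverse edges rooted in `x`, `V_y^{-x}` induces a directed tree rooted in `y`, and the two
components partition `V`. -/
def IsBowTie {α : Type} (V : Set α) (E : α → α → Prop) (x y : α) : Prop :=
  x ∈ V ∧ y ∈ V ∧ E x y ∧
  IsDirTree (wcc (V \ {y}) E x) (fun u v => E v u) x ∧
  IsDirTree (wcc (V \ {x}) E y) E y ∧
  wcc (V \ {y}) E x ∩ wcc (V \ {x}) E y = ∅ ∧
  wcc (V \ {y}) E x ∪ wcc (V \ {x}) E y = V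

/-- `bowtie(A)` for a state atom `q(x, w)`: the weakly connected component of `x` in
`(semterms F, E_R)`. -/
def bowtieOf (F : Set Fact) (x : GroundTerm) : Set GroundTerm := wcc (semterms F) (ER F) x

/-- A maximal `E`-path in the vertex set `V`. -/
def IsMaxPath {α : Type} (V : Set α) (E : α → α → Prop) (l : List α) : Prop :=
  l ≠ [] ∧ (∀ z ∈ l, z ∈ V) ∧ List.Chain' E l ∧
  (∀ z ∈ V, ∀ a, l.head? = some a → ¬ E z a) ∧
  (∀ z ∈ V, ∀ a, l.getLast? = some a → ¬ E a z)

/-- `configs(A)` (Definition 6.4): one candidate configuration per maximal path of `bowtie(A)`. -/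
def configsOf (M : NTM) (F : Set Fact) (A : Fact) : Set (Set Fact) :=
  {S | ∃ q : ℕ, ∃ x w : GroundTerm, A = ((pState q, [x, w]) : Fact) ∧
    ∃ l : List GroundTerm, IsMaxPath (bowtieOf F x) (ER F) l ∧
      S = insert A
        ({f | ∃ z ∈ l, f ∈ brSetF z w} ∪
         {f | f ∈ F ∧ (f.1 = pR ∨ f.1 = pEnd ∨ ∃ a ∈ letters M, f.1 = pLetter a) ∧
           f.2 ≠ [] ∧ f.2.getLast? = some w ∧ ∀ z ∈ f.2.dropLast, z ∈ l})}

/-- Homomorphic embedding of fact sets: a map on nulls (fixing all constants) sending `S`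
into `T`. -/
def mapG (h : ℕ → GroundTerm) : GroundTerm → GroundTerm
  | Sum.inl cc => Sum.inl cc
  | Sum.inr n => h n

def mapFact (h : ℕ → GroundTerm) (f : Fact) : Fact := (f.1, f.2.map (mapG h))

def HomEmbeds (S T : Set Fact) : Prop := ∃ h : ℕ → GroundTerm, ∀ f ∈ S, mapFact h f ∈ T

end ChaseTermination
namespace ChaseTermination

/-! ### The machine `M_Σ` (Definition 4.1), modelled by its canonical runs

A run of `M_Σ` on the encoding of a database corresponds exactly to a restricted chase
derivation of `⟨Σ, D⟩` (step 4 of the procedure) together with the counter `j`; the machine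
visits its designated state `q_r` once each time `j` is incremented (step 5), so a run visits
`q_r` infinitely often iff the derivation is infinite and `jseq` is unbounded. -/

open scoped Classical in
/-- The value of the counter `j` of `M_Σ` after `i` iterations of its main loop, when its
non-deterministic choices build the chase derivation `c`. -/
noncomputable def jseq {S : RuleSet} {D : Set Fact} (c : Chase S D) : ℕ → ℕ
  | 0 => 0
  | i + 1 =>
      if ∀ t : Trigger, Active S (c.fact (jseq c i)) t → obsolete t (c.fact i) then
        jseq c i + 1
      else jseq c i

/-! ### Oblivious and core chase variants -/

/-- A (possibly infinite) oblivious chase derivation: triggers need only be loaded, but no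
trigger (instance) is ever applied twice. -/
structure OblChase (S : RuleSet) (D : Set Fact) where
  len : ℕ∞
  fact : ℕ → Set Fact
  trig : ℕ → Trigger
  ext : ℕ → ℕ → GroundTerm
  init : fact 0 = D
  memAt : ∀ i : ℕ, (i : ℕ∞) < len → (trig i).1 ∈ S
  loadAt : ∀ i : ℕ, (i : ℕ∞) < len → loaded (trig i) (fact i)
  noRepeat : ∀ i j : ℕ, (i : ℕ∞) < len → (j : ℕ∞) < len →
    instOf (trig i) = instOf (trig j) → i = j
  extOk : ∀ i : ℕ, (i : ℕ∞) < len → properExt (trig i) (fact i) (ext i)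
  succ : ∀ i : ℕ, (i : ℕ∞) < len → fact (i + 1) = fact i ∪ outputOf (trig i) (ext i)
  stall : ∀ i : ℕ, ¬ ((i : ℕ∞) < len) → fact (i + 1) = fact i

/-- Fairness for the oblivious chase: every trigger that becomes loaded is eventually applied. -/
def OblFair {S : RuleSet} {D : Set Fact} (c : OblChase S D) : Prop :=
  ∀ t : Trigger, t.1 ∈ S → ∀ i : ℕ, loaded t (c.fact i) →
    ∃ j : ℕ, (j : ℕ∞) < c.len ∧ instOf (c.trig j) = instOf t

/-- `H` is a retract of `G`: `H ⊆ G` and some homomorphism (fixing constants) maps `G` into `H`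
leaving `H` pointwise fixed. -/
def RetractOf (G H : Set Fact) : Prop :=
  H ⊆ G ∧ ∃ h : ℕ → GroundTerm, (∀ f ∈ G, mapFact h f ∈ H) ∧ ∀ f ∈ H, mapFact h f = f

/-- `H` is a core of `G`: a retract of `G` without proper retracts. -/
def IsCoreOf (H G : Set Fact) : Prop := RetractOf G H ∧ ∀ H', RetractOf H H' → H' = H

/-- `G` is obtained from `F` by applying all active triggers in parallel, each with fresh
pairwise distinct nulls (distinct trigger instances use disjoint fresh nulls). -/
def IsParallelStep (S : RuleSet) (F G : Set Fact) : Prop :=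
  ∃ pe : Trigger → (ℕ → GroundTerm),
    (∀ t : Trigger, Active S F t → properExt t F (pe t)) ∧
    (∀ t t' : Trigger, Active S F t → Active S F t' → instOf t = instOf t' →
      outputOf t (pe t) = outputOf t' (pe t')) ∧
    (∀ t t' : Trigger, Active S F t → Active S F t' → instOf t ≠ instOf t' →
      ∀ n : ℕ, (Sum.inr n : GroundTerm) ∉ termsOf F →
        (Sum.inr n : GroundTerm) ∈ termsOf (outputOf t (pe t)) →
        (Sum.inr n : GroundTerm) ∉ termsOf (outputOf t' (pe t'))) ∧
    G = F ∪ ⋃ t ∈ {t : Trigger | Active S F t}, outputOf t (pe t)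

/-- A (possibly infinite) core chase sequence: `F_{i+1}` is a core of the parallel application
of all active triggers to `F_i`, and the sequence stops exactly when this is a fixpoint. -/
structure CoreChase (S : RuleSet) (D : Set Fact) where
  len : ℕ∞
  fact : ℕ → Set Fact
  init : fact 0 = D
  step : ∀ i : ℕ, (i : ℕ∞) < len →
    ∃ G, IsParallelStep S (fact i) G ∧ IsCoreOf (fact (i + 1)) G ∧ fact (i + 1) ≠ fact i
  halt : ∀ i : ℕ, ¬ ((i : ℕ∞) < len) → ∃ G, IsParallelStep S (fact i) G ∧ IsCoreOf (fact i) G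
  stall : ∀ i : ℕ, ¬ ((i : ℕ∞) < len) → fact (i + 1) = fact i

/-- The three chase variants. -/
inductive Variant : Type | obl | rest | core

/-- `qExists` ("sometimes") and `qForall` ("always") termination. -/
inductive Quant : Type | qExists | qForall

/-- `Terminates v q S D`: the knowledge base `⟨S, D⟩` `q`-terminates for the chase variant `v`
(`qExists`: some chase sequence is finite; `qForall`: all chase sequences are finite). -/
def Terminates (v : Variant) (q : Quant) (S : RuleSet) (D : Set Fact) : Prop :=
  match v, q with
  | .rest, .qExists => ∃ c : Chase S D, Fair c ∧ c.len ≠ ⊤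
  | .rest, .qForall => ∀ c : Chase S D, Fair c → c.len ≠ ⊤
  | .obl, .qExists => ∃ c : OblChase S D, OblFair c ∧ c.len ≠ ⊤
  | .obl, .qForall => ∀ c : OblChase S D, OblFair c → c.len ≠ ⊤
  | .core, .qExists => ∃ c : CoreChase S D, c.len ≠ ⊤
  | .core, .qForall => ∀ c : CoreChase S D, c.len ≠ ⊤

end ChaseTermination

namespace ChaseTermination

/-! ### Primitive recursive predicates -/

section PrimrecAux

variable {α β γ : Type} [Primcodable α] [Primcodable β] [Primcodable γ]

theorem _root_.PrimrecPred.imp {p q : α → Prop} (hp : PrimrecPred p) (hq : PrimrecPred q) :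
    PrimrecPred fun a => p a → q a :=
  (hp.not.or hq).of_eq fun _ => by tauto

theorem _root_.PrimrecPred.forall_mem {f : α → List β} {p : α → β → Prop} (hf : Primrec f)
    (hp : PrimrecPred fun x : α × β => p x.1 x.2) : PrimrecPred fun a => ∀ b ∈ f a, p a b := by
  have h : PrimrecRel fun (b : β) (a : α) => p a b :=
    PrimrecPred.comp (f := fun x : β × α => (x.2, x.1)) hp (Primrec.pair .snd .fst)
  exact h.forall_mem_list.comp hf .id

theorem _root_.PrimrecPred.exists_mem {f : α → List β} {p : α → β → Prop} (hf : Primrec f)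
    (hp : PrimrecPred fun x : α × β => p x.1 x.2) : PrimrecPred fun a => ∃ b ∈ f a, p a b := by
  have h : PrimrecRel fun (b : β) (a : α) => p a b :=
    PrimrecPred.comp (f := fun x : β × α => (x.2, x.1)) hp (Primrec.pair .snd .fst)
  exact h.exists_mem_list.comp hf .id

theorem _root_.PrimrecPred.mem {f : α → β} {g : α → List β} (hf : Primrec f) (hg : Primrec g) :
    PrimrecPred fun a => f a ∈ g a :=
  (PrimrecPred.exists_mem (p := fun a b => f a = b) hg
    (Primrec.eq.comp (hf.comp .fst) .snd)).of_eq fun _ => by simp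

theorem _root_.PrimrecPred.isRight {f : α → β ⊕ γ} (hf : Primrec f) :
    PrimrecPred fun a => (f a).isRight = true := by
  refine Primrec.eq.comp ?_ (.const true)
  refine (Primrec.sumCasesOn (g := fun _ _ => false) (h := fun _ _ => true) hf
    (Primrec.const _).to₂ (Primrec.const _).to₂).of_eq fun a => ?_
  cases f a <;> rfl

end PrimrecAux

/-! ### A criterion for membership in `Π¹₁` -/

section Criterion

variable {α T W : Type} [Primcodable α] [Primcodable T] [Primcodable W] [Inhabited W]

/-- The `i`-th entry of a list of codes, decoded. -/
def decodeAt (W : Type) [Primcodable W] [Inhabited W] (u : List ℕ) (i : ℕ) : W :=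
  (Encodable.decode (u.getD i 0)).getD default

theorem primrec_decodeAt : Primrec₂ (decodeAt W) :=
  Primrec.option_getD.comp₂ (Primrec.decode.comp₂ (Primrec.list_getD 0)) (Primrec.const _).to₂

theorem decodeAt_map_range (f : ℕ → ℕ) {i k : ℕ} (h : i < k) :
    decodeAt W ((List.range k).map f) i = (Encodable.decode (f i)).getD default := by
  simp [decodeAt, List.getD_eq_getElem?_getD, h]

open scoped Classical in
/-- A predicate is `Π¹₁` if its failure is witnessed by a sequence `f` satisfying a primitive
recursive condition on all triples of entries `f i`, `f j`, `f (encode t)`. -/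
theorem Pi11.of_forall_seq {p : α → Prop} (Q : α × (ℕ × ℕ × T) × (W × W × W) → Prop)
    (hQ : PrimrecPred Q)
    (hp : ∀ a, ¬ p a ↔ ∃ f : ℕ → W, ∀ (i j : ℕ) (t : T),
      Q (a, (i, j, t), (f i, f j, f (Encodable.encode t)))) : Pi11 p := by
  let args (a : α) (u : List ℕ) (q : ℕ × ℕ × T) : α × (ℕ × ℕ × T) × (W × W × W) :=
    (a, q, (decodeAt W u q.1, decodeAt W u q.2.1, decodeAt W u (Encodable.encode q.2.2)))
  let P (x : (α × List ℕ) × (ℕ × ℕ × T)) : Prop := x.1.2 ≠ [] ∧ ¬ Q (args x.1.1 x.1.2 x.2)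
  have hargs : Primrec fun x : (α × List ℕ) × (ℕ × ℕ × T) => args x.1.1 x.1.2 x.2 := by
    have hu : Primrec fun x : (α × List ℕ) × (ℕ × ℕ × T) => x.1.2 := Primrec.snd.comp .fst
    have hq : Primrec fun x : (α × List ℕ) × (ℕ × ℕ × T) => x.2 := .snd
    exact .pair (Primrec.fst.comp .fst) <| .pair hq <|
      .pair (primrec_decodeAt.comp hu (Primrec.fst.comp hq)) <|
      .pair (primrec_decodeAt.comp hu (Primrec.fst.comp (Primrec.snd.comp hq)))
        (primrec_decodeAt.comp hu
          (Primrec.encode.comp (Primrec.snd.comp (Primrec.snd.comp hq))))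
  have hP : PrimrecPred P :=
    (Primrec.eq.comp (Primrec.snd.comp .fst) (.const [])).not.and (hQ.comp hargs).not
  let R (a : α) (u : List ℕ) : Bool :=
    Option.casesOn (Encodable.decode₂ (ℕ × ℕ × T) (u.length - 1)) false
      fun q => decide (P ((a, u), q))
  have hR : Primrec₂ R := by
    refine Primrec.option_casesOn
      (o := fun x : α × List ℕ => Encodable.decode₂ (ℕ × ℕ × T) (x.2.length - 1))
      (f := fun _ => false) (g := fun x q => decide (P (x, q))) ?_ (.const _) ?_
    · exact Primrec.decode₂.comp (Primrec.nat_sub.comp (Primrec.list_length.comp .snd) (.const 1))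
    · exact hP.decide
  have key (a : α) (g : ℕ → ℕ) (k : ℕ) : R a ((List.range k).map g) = true ↔
      ∃ i j t, Encodable.encode (i, j, t) + 1 = k ∧ ¬ Q (a, (i, j, t),
        ((Encodable.decode (g i)).getD default, (Encodable.decode (g j)).getD default,
          (Encodable.decode (g (Encodable.encode t))).getD default)) := by
    have args_eq (i j : ℕ) (t : T) (h : Encodable.encode (i, j, t) < k) :
        args a ((List.range k).map g) (i, j, t) = (a, (i, j, t),
          ((Encodable.decode (g i)).getD default, (Encodable.decode (g j)).getD default,
            (Encodable.decode (g (Encodable.encode t))).getD default)) := by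
      have h1 : i ≤ Encodable.encode (i, j, t) := Nat.left_le_pair _ _
      have h2 : Nat.pair j (Encodable.encode t) ≤ Encodable.encode (i, j, t) :=
        Nat.right_le_pair _ _
      have h3 := Nat.left_le_pair j (Encodable.encode t)
      have h4 := Nat.right_le_pair j (Encodable.encode t)
      simp only [args]
      rw [decodeAt_map_range g (by omega), decodeAt_map_range g (by omega),
        decodeAt_map_range g (by omega)]
    obtain _ | k := k
    · have h0 : R a [] = false := by
        simp only [R]
        cases Encodable.decode₂ (ℕ × ℕ × T) (([] : List ℕ).length - 1) <;> simp [P]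
      simp [h0]
    · simp only [R, List.length_map, List.length_range, Nat.add_sub_cancel]
      rcases hd : Encodable.decode₂ (ℕ × ℕ × T) k with _ | ⟨i, j, t⟩
      · simp only [Bool.false_eq_true, false_iff]
        rintro ⟨i, j, t, h, -⟩
        rw [← Nat.succ.inj h, Encodable.encodek₂] at hd
        cases hd
      · have hk : Encodable.encode (i, j, t) = k := Encodable.mem_decode₂.1 hd
        simp only [P, decide_eq_true_eq]
        rw [args_eq i j t (by omega)]
        refine ⟨fun h => ⟨i, j, t, by omega, h.2⟩, ?_⟩
        rintro ⟨i', j', t', h, hn⟩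
        cases Encodable.encode_injective ((Nat.succ.inj h).trans hk.symm)
        exact ⟨by simp, hn⟩
  refine ⟨R, hR.to_comp, fun a => ?_⟩
  rw [← not_iff_not, hp]
  simp only [key]
  push Not
  constructor
  · rintro ⟨f, hf⟩
    exact ⟨fun n => Encodable.encode (f n), fun k i j t _ => by simpa using hf i j t⟩
  · rintro ⟨g, hg⟩
    exact ⟨fun n => (Encodable.decode (g n)).getD default, fun i j t => hg _ i j t rfl⟩

end Criterion

/-! ### Finite substitutions -/

/-- The substitution given by a list of ground terms. -/
def listSubst (l : List GroundTerm) (v : ℕ) : GroundTerm := l.getD v (Sum.inl 0)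

theorem applyA_congr {σ τ : ℕ → GroundTerm} {a : Atom}
    (h : ∀ v, atomHasVar a v → σ v = τ v) : applyA σ a = applyA τ a := by
  refine Prod.ext rfl (List.map_congr_left fun t ht => ?_)
  rcases t with v | g
  · exact h v ht
  · rfl

theorem eq_of_applyA_eq {σ τ : ℕ → GroundTerm} {a : Atom} (h : applyA σ a = applyA τ a) {v : ℕ}
    (hv : atomHasVar a v) : σ v = τ v :=
  List.map_inj_left.1 (congrArg Prod.snd h) (Sum.inl v) hv

theorem agreesOnBody_iff (r : Rule) (σ τ : ℕ → GroundTerm) :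
    agreesOnBody (r, σ) τ ↔ ∀ a ∈ r.1, applyA τ a = applyA σ a :=
  ⟨fun h a ha => applyA_congr fun v hv => h v ⟨a, ha, hv⟩,
    fun h _ ⟨a, ha, hv⟩ => eq_of_applyA_eq (h a ha) hv⟩

/-- Every substitution agrees on the variables of a finite list of atoms with a finite one. -/
theorem exists_listSubst (L : List Atom) (σ : ℕ → GroundTerm) :
    ∃ l, ∀ a ∈ L, ∀ v, atomHasVar a v → listSubst l v = σ v := by
  have hb : ∃ N, ∀ a ∈ L, ∀ v, atomHasVar a v → v < N := by
    induction L with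
    | nil => exact ⟨0, by simp⟩
    | cons a L ih =>
      obtain ⟨N, hN⟩ := ih
      have ha : ∀ ts : List RTerm, ∃ N, ∀ v, (Sum.inl v : RTerm) ∈ ts → v < N := by
        intro ts
        induction ts with
        | nil => exact ⟨0, by simp⟩
        | cons t ts iht =>
          obtain ⟨M, hM⟩ := iht
          refine ⟨max M (Sum.elim (· + 1) (fun _ => 0) t), fun v hv => ?_⟩
          rcases List.mem_cons.1 hv with rfl | hv
          · simp
          · exact lt_max_of_lt_left (hM v hv)
      obtain ⟨M, hM⟩ := ha a.2
      refine ⟨max M N, fun b hb v hv => ?_⟩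
      rcases List.mem_cons.1 hb with rfl | hb
      · exact lt_max_of_lt_left (hM v hv)
      · exact lt_max_of_lt_right (hN b hb v hv)
  obtain ⟨N, hN⟩ := hb
  refine ⟨(List.range N).map σ, fun a ha v hv => ?_⟩
  simp [listSubst, List.getD_eq_getElem?_getD, hN a ha v hv]

theorem primrec_applyT_listSubst :
    Primrec₂ fun (l : List GroundTerm) (t : RTerm) => applyT (listSubst l) t := by
  refine (Primrec.sumCasesOn (f := fun x : List GroundTerm × RTerm => x.2)
    (g := fun x v => listSubst x.1 v) (h := fun _ g => g) .snd
    ((Primrec.list_getD _).comp (Primrec.fst.comp .fst) .snd) Primrec.snd).of_eq ?_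
  rintro ⟨l, v | g⟩ <;> rfl

theorem primrec_applyA_listSubst :
    Primrec₂ fun (l : List GroundTerm) (a : Atom) => applyA (listSubst l) a :=
  Primrec.pair (Primrec.fst.comp .snd)
    (Primrec.list_map (Primrec.snd.comp .snd)
      (primrec_applyT_listSubst.comp (Primrec.fst.comp .fst) .snd))

/-! ### Primitive recursiveness of the ingredients of a chase step -/

section ChaseStepPrimrec

variable {α : Type} [Primcodable α]

theorem primrecPred_isRuleSet {S : α → RuleSet} (hS : Primrec S) :
    PrimrecPred fun x => IsRuleSet (S x) := by
  have hterm : PrimrecPred fun t : RTerm => ∀ n : ℕ, t ≠ Sum.inr (Sum.inr n) := by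
    have h : Primrec fun t : RTerm => Sum.elim (fun _ => (Sum.inl 0 : GroundTerm)) id t :=
      (Primrec.sumCasesOn (f := fun t : RTerm => t)
        (g := fun _ _ => (Sum.inl 0 : GroundTerm)) (h := fun _ g => g) .id
        (Primrec.const _).to₂ Primrec.snd).of_eq (by rintro (v | g) <;> rfl)
    refine (PrimrecPred.isRight h).not.of_eq ?_
    rintro (v | c | n) <;> simp
  have hatom : PrimrecPred fun a : Atom => atomNullFree a :=
    PrimrecPred.forall_mem Primrec.snd (hterm.comp .snd)
  have hrule : PrimrecPred fun r : Rule => IsRule r :=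
    (Primrec.eq.comp .snd (.const [])).not.and
      (PrimrecPred.forall_mem (Primrec.list_append.comp .fst .snd) (hatom.comp .snd))
  exact PrimrecPred.forall_mem hS (hrule.comp .snd)

theorem primrecPred_isDatabase {F : α → List Fact} (hF : Primrec F) :
    PrimrecPred fun x => IsDatabase (F x) := by
  have hterm : PrimrecPred fun t : GroundTerm => ∀ n : ℕ, t ≠ Sum.inr n := by
    refine (PrimrecPred.isRight Primrec.id).not.of_eq ?_
    rintro (c | n) <;> simp
  have hfact : PrimrecPred fun f : Fact => factNullFree f :=
    PrimrecPred.forall_mem Primrec.snd (hterm.comp .snd)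
  exact PrimrecPred.forall_mem hF (hfact.comp .snd)

theorem primrecPred_applyA_mem {L : α → List Atom} {l : α → List GroundTerm}
    {F : α → List Fact} (hL : Primrec L) (hl : Primrec l) (hF : Primrec F) :
    PrimrecPred fun x => ∀ a ∈ L x, applyA (listSubst (l x)) a ∈ F x :=
  PrimrecPred.forall_mem hL <|
    PrimrecPred.mem (primrec_applyA_listSubst.comp (hl.comp .fst) .snd) (hF.comp .fst)

theorem primrecPred_agreesOnBody {r : α → Rule} {l m : α → List GroundTerm}
    (hr : Primrec r) (hl : Primrec l) (hm : Primrec m) :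
    PrimrecPred fun x => agreesOnBody (r x, listSubst (l x)) (listSubst (m x)) := by
  refine (PrimrecPred.forall_mem
    (p := fun x a => applyA (listSubst (m x)) a = applyA (listSubst (l x)) a)
    (Primrec.fst.comp hr) ?_).of_eq fun x => (agreesOnBody_iff _ _ _).symm
  exact Primrec.eq.comp (primrec_applyA_listSubst.comp (hm.comp .fst) .snd)
    (primrec_applyA_listSubst.comp (hl.comp .fst) .snd)

theorem primrecPred_existVar {r : α → Rule} {v : α → ℕ} (hr : Primrec r) (hv : Primrec v) :
    PrimrecPred fun x => existVar (r x) (v x) := by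
  have h {L : α → List Atom} (hL : Primrec L) :
      PrimrecPred fun x => ∃ a ∈ L x, atomHasVar a (v x) :=
    PrimrecPred.exists_mem hL <|
      PrimrecPred.mem (Primrec.sumInl.comp (hv.comp .fst)) (Primrec.snd.comp .snd)
  exact (h (Primrec.snd.comp hr)).and (h (Primrec.fst.comp hr)).not

end ChaseStepPrimrec

/-! ### Coded chase sequences -/

/-- An entry of a coded chase sequence: the facts derived so far, the rule applied next with its
substitution, and a step at which the trigger coded by the position of the entry is obsolete,
with a substitution witnessing this. -/
abbrev Entry : Type := List Fact × (Rule × List GroundTerm) × (ℕ × List GroundTerm)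

/-- Data over which the conditions on a coded chase sequence quantify: a trigger and
two variables. -/
abbrev Query : Type := (Rule × List GroundTerm) × ℕ × ℕ

instance : Primcodable Entry := inferInstance

instance : Primcodable Query := inferInstance

/-- The local conditions making a sequence of entries an infinite fair chase sequence. -/
def ChaseCond (x : RuleSet × (ℕ × ℕ × Query) × (Entry × Entry × Entry)) : Prop :=
  let S := x.1
  let i := x.2.1.1
  let j := x.2.1.2.1
  let t := x.2.1.2.2.1
  let v := x.2.1.2.2.2.1
  let w := x.2.1.2.2.2.2
  let F := x.2.2.1.1
  let r := x.2.2.1.2.1.1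
  let l := x.2.2.1.2.1.2
  let G := x.2.2.2.1.1
  let k := x.2.2.2.2.2.2.1
  let m := x.2.2.2.2.2.2.2
  (i = 0 → IsDatabase F) ∧
  r ∈ S ∧
  (∀ a ∈ r.1, applyA (listSubst l) a ∈ F) ∧
  ¬ (agreesOnBody (r, listSubst l) (listSubst t.2) ∧ ∀ a ∈ r.2, applyA (listSubst t.2) a ∈ F) ∧
  (existVar r v → (listSubst l v).isRight = true ∧ ¬ ∃ f ∈ F, listSubst l v ∈ f.2) ∧
  (existVar r v → existVar r w → listSubst l v = listSubst l w → v = w) ∧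
  (j = i + 1 → G = F ++ r.2.map (applyA (listSubst l))) ∧
  (t.1 ∈ S → (∀ a ∈ t.1.1, applyA (listSubst t.2) a ∈ F) → j = k →
    agreesOnBody (t.1, listSubst t.2) (listSubst m) ∧
      ∀ a ∈ t.1.2, applyA (listSubst m) a ∈ G)

theorem primrecPred_chaseCond : PrimrecPred ChaseCond := by
  let X := RuleSet × (ℕ × ℕ × Query) × (Entry × Entry × Entry)
  have hS : Primrec fun x : X => x.1 := .fst
  have hx : Primrec fun x : X => x.2.1 := Primrec.fst.comp .snd
  have hi : Primrec fun x : X => x.2.1.1 := Primrec.fst.comp hx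
  have hx' : Primrec fun x : X => x.2.1.2 := Primrec.snd.comp hx
  have hj : Primrec fun x : X => x.2.1.2.1 := Primrec.fst.comp hx'
  have hq : Primrec fun x : X => x.2.1.2.2 := Primrec.snd.comp hx'
  have ht : Primrec fun x : X => x.2.1.2.2.1 := Primrec.fst.comp hq
  have htr : Primrec fun x : X => x.2.1.2.2.1.1 := Primrec.fst.comp ht
  have htl : Primrec fun x : X => x.2.1.2.2.1.2 := Primrec.snd.comp ht
  have hvw : Primrec fun x : X => x.2.1.2.2.2 := Primrec.snd.comp hq
  have hv : Primrec fun x : X => x.2.1.2.2.2.1 := Primrec.fst.comp hvw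
  have hw : Primrec fun x : X => x.2.1.2.2.2.2 := Primrec.snd.comp hvw
  have hy : Primrec fun x : X => x.2.2 := Primrec.snd.comp .snd
  have hy₁ : Primrec fun x : X => x.2.2.1 := Primrec.fst.comp hy
  have hF : Primrec fun x : X => x.2.2.1.1 := Primrec.fst.comp hy₁
  have hstep : Primrec fun x : X => x.2.2.1.2.1 := Primrec.fst.comp (Primrec.snd.comp hy₁)
  have hr : Primrec fun x : X => x.2.2.1.2.1.1 := Primrec.fst.comp hstep
  have hl : Primrec fun x : X => x.2.2.1.2.1.2 := Primrec.snd.comp hstep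
  have hy₂ : Primrec fun x : X => x.2.2.2 := Primrec.snd.comp hy
  have hG : Primrec fun x : X => x.2.2.2.1.1 := Primrec.fst.comp (Primrec.fst.comp hy₂)
  have hwit : Primrec fun x : X => x.2.2.2.2.2.2 :=
    Primrec.snd.comp (Primrec.snd.comp (Primrec.snd.comp hy₂))
  have hk : Primrec fun x : X => x.2.2.2.2.2.2.1 := Primrec.fst.comp hwit
  have hm : Primrec fun x : X => x.2.2.2.2.2.2.2 := Primrec.snd.comp hwit
  have hlv : Primrec fun x : X => listSubst x.2.2.1.2.1.2 x.2.1.2.2.2.1 :=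
    (Primrec.list_getD _).comp hl hv
  have hlw : Primrec fun x : X => listSubst x.2.2.1.2.1.2 x.2.1.2.2.2.2 :=
    (Primrec.list_getD _).comp hl hw
  have hout : Primrec fun x : X =>
      x.2.2.1.2.1.1.2.map (applyA (listSubst x.2.2.1.2.1.2)) :=
    Primrec.list_map (g := fun x a => applyA (listSubst x.2.2.1.2.1.2) a) (Primrec.snd.comp hr)
      (primrec_applyA_listSubst.comp (hl.comp .fst) .snd)
  refine ((Primrec.eq.comp hi (.const 0)).imp (primrecPred_isDatabase hF)).and ?_
  refine (PrimrecPred.mem hr hS).and ?_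
  refine (primrecPred_applyA_mem (Primrec.fst.comp hr) hl hF).and ?_
  refine ((primrecPred_agreesOnBody hr hl htl).and
    (primrecPred_applyA_mem (Primrec.snd.comp hr) htl hF)).not.and ?_
  refine ((primrecPred_existVar hr hv).imp ((PrimrecPred.isRight hlv).and
    (PrimrecPred.exists_mem hF
      (PrimrecPred.mem (hlv.comp .fst) (Primrec.snd.comp .snd))).not)).and ?_
  refine ((primrecPred_existVar hr hv).imp ((primrecPred_existVar hr hw).imp
    ((Primrec.eq.comp hlv hlw).imp (Primrec.eq.comp hv hw)))).and ?_
  refine ((Primrec.eq.comp hj (Primrec.succ.comp hi)).imp (Primrec.eq.comp hG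
    (Primrec.list_append.comp hF hout))).and ?_
  exact (PrimrecPred.mem htr hS).imp <|
    (primrecPred_applyA_mem (Primrec.fst.comp htr) htl hF).imp <|
    (Primrec.eq.comp hj hk).imp <|
    (primrecPred_agreesOnBody htr htl hm).and
      (primrecPred_applyA_mem (Primrec.snd.comp htr) hm hG)

theorem obsolete_mono {t : Trigger} {F G : Set Fact} (h : F ⊆ G) : obsolete t F → obsolete t G :=
  fun ⟨σ, hσ, hF⟩ => ⟨σ, hσ, fun a ha => h (hF a ha)⟩

theorem Chase.fact_mono {S : RuleSet} {D : Set Fact} (c : Chase S D) : Monotone c.fact := by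
  refine monotone_nat_of_le_succ fun i => ?_
  by_cases h : (i : ℕ∞) < c.len
  · rw [c.succ i h]
    exact Set.subset_union_left
  · rw [c.stall i h]

/-- A sequence of entries satisfying the local conditions yields an infinite fair chase
sequence. -/
theorem exists_chase_of_chaseCond {S : RuleSet} {f : ℕ → Entry}
    (hf : ∀ (i j : ℕ) (t : Query), ChaseCond (S, (i, j, t), (f i, f j, f (Encodable.encode t)))) :
    IsDatabase (f 0).1 ∧ ∃ c : Chase S (dbSet (f 0).1), IsInfinite c ∧ Fair c := by
  have hmem (i : ℕ) := (hf i 0 default).2.1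
  have hload (i : ℕ) := (hf i 0 default).2.2.1
  have hsucc (i : ℕ) := (hf i (i + 1) default).2.2.2.2.2.2.1 rfl
  simp only at hmem hload hsucc
  let c : Chase S (dbSet (f 0).1) :=
    { len := ⊤
      fact := fun i => {x | x ∈ (f i).1}
      trig := fun i => ((f i).2.1.1, listSubst (f i).2.1.2)
      ext := fun i => listSubst (f i).2.1.2
      init := rfl
      activeAt := by
        refine fun i _ => ⟨hmem i, hload i, ?_⟩
        rintro ⟨σ, hσ, hF⟩
        obtain ⟨l, hl⟩ := exists_listSubst ((f i).2.1.1.1 ++ (f i).2.1.1.2) σ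
        refine (hf i 0 (((f i).2.1.1, l), 0, 0)).2.2.2.1 ⟨?_, fun a ha => ?_⟩
        · rintro v ⟨a, ha, hv⟩
          exact (hl a (List.mem_append_left _ ha) v hv).trans (hσ v ⟨a, ha, hv⟩)
        · have h := hF a ha
          rwa [← applyA_congr (hl a (List.mem_append_right _ ha))] at h
      extOk := by
        refine fun i _ => ⟨fun _ _ => rfl, fun v hv => ?_, fun v w hv hw =>
          (hf i 0 (default, v, w)).2.2.2.2.2.1 hv hw⟩
        obtain ⟨h₁, h₂⟩ := (hf i 0 (default, v, 0)).2.2.2.2.1 hv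
        obtain ⟨n, hn⟩ := Sum.isRight_iff.1 h₁
        exact ⟨n, hn, fun h => h₂ (hn ▸ h)⟩
      succ := by
        intro i _
        ext x
        simp [hsucc i, outputOf, eq_comm]
      stall := fun i h => absurd (ENat.natCast_lt_top i) h }
  refine ⟨(hf 0 0 default).1 rfl, c, rfl, ?_⟩
  rintro ⟨r, σ⟩ hr i hi
  obtain ⟨l, hl⟩ := exists_listSubst (r.1 ++ r.2) σ
  let t : Query := ((r, l), 0, 0)
  obtain ⟨hm, hG⟩ := (hf i (f (Encodable.encode t)).2.2.1 t).2.2.2.2.2.2.2 hr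
    (fun a ha => by
      have h := hi a ha
      rwa [← applyA_congr (hl a (List.mem_append_left _ ha))] at h) rfl
  refine ⟨max i (f (Encodable.encode t)).2.2.1, le_max_left _ _,
    obsolete_mono (c.fact_mono (le_max_right _ _)) ⟨_, ?_, hG⟩⟩
  rintro v ⟨a, ha, hv⟩
  exact (hm v ⟨a, ha, hv⟩).trans (hl a (List.mem_append_left _ ha) v hv)

/-- The fact lists produced from `D` by successively applying the given rules and
substitutions. -/
def factSeq (D : List Fact) (step : ℕ → Rule × List GroundTerm) : ℕ → List Fact
  | 0 => D
  | i + 1 => factSeq D step i ++ (step i).1.2.map (applyA (listSubst (step i).2))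

/-- An infinite fair chase sequence can be coded by a sequence of entries satisfying the local
conditions. -/
theorem exists_chaseCond_of_chase {S : RuleSet} {D : Database} (hD : IsDatabase D)
    (c : Chase S (dbSet D)) (hc : IsInfinite c) (hfair : Fair c) :
    ∃ f : ℕ → Entry, ∀ (i j : ℕ) (t : Query),
      ChaseCond (S, (i, j, t), (f i, f j, f (Encodable.encode t))) := by
  have hlt (i : ℕ) : (i : ℕ∞) < c.len := hc.symm ▸ ENat.natCast_lt_top i
  choose l hl using fun i => exists_listSubst ((c.trig i).1.1 ++ (c.trig i).1.2) (c.ext i)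
  have hbody (i : ℕ) : ∀ a ∈ (c.trig i).1.1, applyA (listSubst (l i)) a = applyA (c.trig i).2 a :=
    fun a ha => applyA_congr fun v hv =>
      (hl i a (List.mem_append_left _ ha) v hv).trans ((c.extOk i (hlt i)).1 v ⟨a, ha, hv⟩)
  have hhead (i : ℕ) : ∀ a ∈ (c.trig i).1.2, applyA (listSubst (l i)) a = applyA (c.ext i) a :=
    fun a ha => applyA_congr (hl i a (List.mem_append_right _ ha))
  have hexist (i v : ℕ) (hv : existVar (c.trig i).1 v) : listSubst (l i) v = c.ext i v := by
    obtain ⟨⟨a, ha, hv⟩, -⟩ := hv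
    exact hl i a (List.mem_append_right _ ha) v hv
  let F := factSeq D fun i => ((c.trig i).1, l i)
  have hF (i : ℕ) : c.fact i = {x | x ∈ F i} := by
    induction i with
    | zero => exact c.init
    | succ i ih =>
      rw [c.succ i (hlt i), ih]
      ext x
      simp only [F, factSeq, outputOf, Set.mem_union, Set.mem_ofPred_eq, List.mem_append,
        List.mem_map]
      refine or_congr_right ⟨?_, ?_⟩
      · rintro ⟨a, ha, rfl⟩
        exact ⟨a, ha, hhead i a ha⟩
      · rintro ⟨a, ha, rfl⟩
        exact ⟨a, ha, hhead i a ha⟩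
  have hwit (t : Query) : ∃ k m, t.1.1 ∈ S →
      ∀ i, (∀ a ∈ t.1.1.1, applyA (listSubst t.1.2) a ∈ F i) →
        agreesOnBody (t.1.1, listSubst t.1.2) (listSubst m) ∧
          ∀ a ∈ t.1.1.2, applyA (listSubst m) a ∈ F k := by
    by_cases h : t.1.1 ∈ S ∧ ∃ i, ∀ a ∈ t.1.1.1, applyA (listSubst t.1.2) a ∈ F i
    · obtain ⟨hr, i, hi⟩ := h
      obtain ⟨k, -, σ, hσ, hk⟩ := hfair (t.1.1, listSubst t.1.2) hr i (by rwa [hF i])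
      obtain ⟨m, hm⟩ := exists_listSubst (t.1.1.1 ++ t.1.1.2) σ
      refine ⟨k, m, fun _ _ _ => ⟨?_, fun a ha => ?_⟩⟩
      · rintro v ⟨a, ha, hv⟩
        exact (hm a (List.mem_append_left _ ha) v hv).trans (hσ v ⟨a, ha, hv⟩)
      · have h := hk a ha
        rwa [hF k, ← applyA_congr (hm a (List.mem_append_right _ ha))] at h
    · exact ⟨0, [], fun hr i hi => absurd ⟨hr, i, hi⟩ h⟩
  choose k m hkm using hwit
  let wit (n : ℕ) : ℕ × List GroundTerm :=
    ((Encodable.decode (α := Query) n).map fun t => (k t, m t)).getD default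
  have hwit_encode (t : Query) : wit (Encodable.encode t) = (k t, m t) := by
    simp only [wit, Encodable.encodek, Option.map_some, Option.getD_some]
  refine ⟨fun n => (F n, ((c.trig n).1, l n), wit n), fun i j t => ?_⟩
  obtain ⟨hmem, hload, hobs⟩ := c.activeAt i (hlt i)
  obtain ⟨-, hfresh, hinj⟩ := c.extOk i (hlt i)
  refine ⟨?_, hmem, fun a ha => ?_, ?_, fun hv => ?_, fun hv hw h => ?_, ?_, ?_⟩
  · rintro rfl
    exact hD
  · have h := hload a ha
    rwa [hF i, ← hbody i a ha] at h
  · rintro ⟨hag, hin⟩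
    refine hobs ⟨listSubst t.1.2, ?_, fun a ha => by rw [hF i]; exact hin a ha⟩
    refine (agreesOnBody_iff _ _ _).2 fun a ha => ?_
    exact ((agreesOnBody_iff _ _ _).1 hag a ha).trans (hbody i a ha)
  · obtain ⟨n, hn, hfr⟩ := hfresh _ hv
    simp only [hexist i _ hv, hn]
    rw [hF i] at hfr
    exact ⟨rfl, hfr⟩
  · simp only [hexist i _ hv, hexist i _ hw] at h
    exact hinj _ _ hv hw h
  · intro h
    simp only at h
    subst h
    rfl
  · intro hr hi hj
    simp only [hwit_encode] at hj ⊢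
    subst hj
    exact hkm t hr i hi

theorem not_TRRall_iff (S : RuleSet) : ¬ TRRall S ↔ ∃ f : ℕ → Entry,
    ∀ (i j : ℕ) (t : Query), ¬ IsRuleSet S ∨
      ChaseCond (S, (i, j, t), (f i, f j, f (Encodable.encode t))) := by
  by_cases hS : IsRuleSet S
  · simp only [TRRall, hS, not_true_eq_false, false_or, true_and]
    push Not
    constructor
    · rintro ⟨D, hD, c, hc, hfair⟩
      exact exists_chaseCond_of_chase hD c hc hfair
    · rintro ⟨f, hf⟩
      exact ⟨_, exists_chase_of_chaseCond hf⟩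
  · simp [TRRall, hS]

/-- Deciding membership in `TRR∀` (the class of finite rule sets `Σ` such that
every restricted chase sequence of `⟨Σ, D⟩` is finite for every database `D`) is in `Π¹₁`. -/
theorem TRRall_in_Pi11 : Pi11 TRRall :=
  Pi11.of_forall_seq
    (fun x : RuleSet × (ℕ × ℕ × Query) × (Entry × Entry × Entry) => ¬ IsRuleSet x.1 ∨ ChaseCond x)
    ((primrecPred_isRuleSet Primrec.fst).not.or primrecPred_chaseCond) not_TRRall_iff

end ChaseTermination
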